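/- The functional code C_2(X) of quadratic forms on the Hermitian surface X in PG(3,t^2) has length (t^2+1)(t^3+1), dimension 10, and minimum distance t^5 - t^3 - t^2 + t = t(t-1)(t^3+t^2-1). -/

import Mathlib

open LinearAlgebra.Projectivization Projectivization Finset

/-- The Hermitian surface in `PG(3,q)`, `q = t²`. -/
def hermSurf (t : ℕ) (F : Type) [Field F] : Set (ℙ F (Fin 4 → F)) :=
  {x | ∑ i : Fin 4, (x.rep i) ^ (t + 1) = 0}

/-- The tangent plane to the Hermitian surface at a point `P`, given by the
Hermitian polarity `∑ xᵢ · (Pᵢ)^t = 0`. -/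
def hermTangentPlane (t : ℕ) (F : Type) [Field F] (P : ℙ F (Fin 4 → F)) :
    Set (ℙ F (Fin 4 → F)) :=
  {x | ∑ i : Fin 4, x.rep i * (P.rep i) ^ t = 0}

/-- The set of projective points of a linear subspace `W` (a plane if
`finrank W = 3`, a line if `finrank W = 2`). -/
def projSet (F : Type) [Field F] (W : Submodule F (Fin 4 → F)) : Set (ℙ F (Fin 4 → F)) :=
  {x | x.submodule ≤ W}
/-- Evaluation of polynomials at the (fixed) representatives of the points of the
Hermitian surface, as a linear map. -/
noncomputable def hermEval (t : ℕ) (F : Type) [Field F] :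
    MvPolynomial (Fin 4) F →ₗ[F] (↥(hermSurf t F) → F) where
  toFun f := fun x => MvPolynomial.eval (x : ℙ F (Fin 4 → F)).rep f
  map_add' f g := by funext x; simp
  map_smul' c f := by funext x; simp

/-- The functional code `C_h(X)` of degree-`h` forms on the Hermitian surface. -/
noncomputable def hermCode (t : ℕ) (F : Type) [Field F] (h : ℕ) : Submodule F (↥(hermSurf t F) → F) :=
  (MvPolynomial.homogeneousSubmodule (Fin 4) F h).map (hermEval t F)

/-- The weight of a codeword: the number of nonzero coordinates. -/
noncomputable def wt (t : ℕ) (F : Type) [Field F] (c : ↥(hermSurf t F) → F) : ℕ :=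
  Nat.card {x : ↥(hermSurf t F) // c x ≠ 0}
section counting

variable {F : Type} [Field F] [Fintype F] [DecidableEq F]

theorem card_roots_le (P : Polynomial F) (hP : P ≠ 0) :
    #{x : F | P.eval x = 0} ≤ P.natDegree := by
  refine le_trans (Finset.card_le_card (t := P.roots.toFinset) ?_)
    ((Multiset.toFinset_card_le _).trans P.card_roots')
  intro x hx
  simpa [hP] using hx

theorem card_filter_prod {α β : Type*} [Fintype α] [Fintype β] (P : α × β → Prop)
    [DecidablePred P] : #{p : α × β | P p} = ∑ b, #{a : α | P (a, b)} := by
  simp only [Finset.card_filter]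
  exact Fintype.sum_prod_type_right _

theorem card_quadratic_le_two {α β γ : F} (h : ¬ (α = 0 ∧ β = 0 ∧ γ = 0)) :
    #{x : F | α * x ^ 2 + β * x + γ = 0} ≤ 2 := by
  open Polynomial in
  have hP : (C α * X ^ 2 + C β * X + C γ : F[X]) ≠ 0 := by
    intro h0
    apply h
    refine ⟨?_, ?_, ?_⟩
    · simpa using congrArg (fun p => p.coeff 2) h0
    · simpa using congrArg (fun p => p.coeff 1) h0
    · simpa using congrArg (fun p => p.coeff 0) h0
  refine le_trans ?_ ((card_roots_le _ hP).trans Polynomial.natDegree_quadratic_le)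
  simp

theorem card_affine_le {α β : F} (γ : F) (h : ¬ (α = 0 ∧ β = 0)) :
    #{x : F × F | α * x.1 + β * x.2 + γ = 0} ≤ Fintype.card F := by
  by_cases hα : α = 0
  · have hβ : β ≠ 0 := fun hβ => h ⟨hα, hβ⟩
    refine Finset.card_le_card_of_injOn (t := Finset.univ) Prod.fst (by simp) ?_
    rintro ⟨x, y⟩ hx ⟨x', y'⟩ hx' rfl
    simp only [coe_filter, mem_univ, true_and, Set.mem_ofPred_eq, hα] at hx hx'
    have : β * (y - y') = 0 := by linear_combination hx - hx'
    simpa [hβ, sub_eq_zero] using this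
  · refine Finset.card_le_card_of_injOn (t := Finset.univ) Prod.snd (by simp) ?_
    rintro ⟨x, y⟩ hx ⟨x', y'⟩ hx' rfl
    simp only [coe_filter, mem_univ, true_and, Set.mem_ofPred_eq] at hx hx'
    have : α * (x - x') = 0 := by linear_combination hx - hx'
    simpa [hα, sub_eq_zero] using this

theorem card_binary_quadratic_lt {α β γ : F} (h : ¬ (α = 0 ∧ β = 0 ∧ γ = 0)) :
    #{x : F × F | α * x.1 ^ 2 + β * (x.1 * x.2) + γ * x.2 ^ 2 = 0} < 2 * Fintype.card F := by
  by_cases hα : α = 0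
  · have hβ : ¬ (β = 0 ∧ γ = 0) := fun hβ => h ⟨hα, hβ⟩
    have h1 : #({x : F × F | β * x.1 + γ * x.2 + 0 = 0} : Finset _) ≤ Fintype.card F :=
      card_affine_le 0 hβ
    have h2 : #({x : F × F | 0 * x.1 + 1 * x.2 + 0 = 0} : Finset _) ≤ Fintype.card F :=
      card_affine_le 0 (by simp)
    have hsub : ({x : F × F | α * x.1 ^ 2 + β * (x.1 * x.2) + γ * x.2 ^ 2 = 0} : Finset _) ⊆
        ({x : F × F | β * x.1 + γ * x.2 + 0 = 0} : Finset _) ∪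
          ({x : F × F | 0 * x.1 + 1 * x.2 + 0 = 0} : Finset _) := by
      intro x hx
      simp only [mem_filter, mem_univ, true_and, hα, mem_union] at hx ⊢
      have : (β * x.1 + γ * x.2 + 0) * (0 * x.1 + 1 * x.2 + 0) = 0 := by linear_combination hx
      exact mul_eq_zero.mp this
    have h3 := Finset.card_le_card hsub
    have h4 := Finset.card_union_add_card_inter
      ({x : F × F | β * x.1 + γ * x.2 + 0 = 0} : Finset _)
          ({x : F × F | 0 * x.1 + 1 * x.2 + 0 = 0} : Finset _)
    have h5 : 0 < #(({x : F × F | β * x.1 + γ * x.2 + 0 = 0} : Finset _) ∩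
          ({x : F × F | 0 * x.1 + 1 * x.2 + 0 = 0} : Finset _)) :=
      Finset.card_pos.mpr ⟨0, by simp⟩
    lia
  · rw [card_filter_prod]
    calc ∑ b : F, #{a : F | α * (a, b).1 ^ 2 + β * ((a, b).1 * (a, b).2) + γ * (a, b).2 ^ 2 = 0}
        < ∑ _b : F, 2 := by
          refine Finset.sum_lt_sum (fun b _ => ?_) ⟨0, Finset.mem_univ _, ?_⟩
          · refine le_trans (le_of_eq ?_) (card_quadratic_le_two (α := α) (β := β * b)
              (γ := γ * b ^ 2) (fun hh => hα hh.1))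
            congr 1; ext a; simp only [mem_filter, mem_univ, true_and]
            rw [← mul_assoc, mul_right_comm]
          · refine lt_of_le_of_lt (b := #({0} : Finset F)) (Finset.card_le_card ?_) (by simp)
            intro x hx
            simpa [hα] using hx
      _ = 2 * Fintype.card F := by simp [mul_comm]

end counting

section trace

variable {F : Type} [Field F] [Fintype F] [DecidableEq F] {t : ℕ} {σ : F →+* F}

theorem card_trace_eq_zero_le (ht : 1 < t) (hσ : ∀ x, σ x = x ^ t) :
    #{x : F | x + σ x = 0} ≤ t := by
  open Polynomial in
  have hd : (X ^ t + X : F[X]).natDegree = t := by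
    compute_degree!
    · simp [ht.ne]
    · lia
  have hP : (X ^ t + X : F[X]) ≠ 0 := by
    intro h; rw [h] at hd; simp at hd; lia
  have := card_roots_le _ hP
  rw [hd] at this
  simpa [hσ, add_comm] using this

theorem card_fixed_le (ht : 1 < t) (hσ : ∀ x, σ x = x ^ t) :
    #{x : F | σ x = x} ≤ t := by
  open Polynomial in
  have hd : (X ^ t - X : F[X]).natDegree = t := by
    compute_degree!
    · simp [ht.ne]
    · lia
  have hP : (X ^ t - X : F[X]) ≠ 0 := by
    intro h; rw [h] at hd; simp at hd; lia
  have := card_roots_le _ hP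
  rw [hd] at this
  simpa [hσ, sub_eq_zero] using this

theorem card_trace_eq_zero (ht : 1 < t) (hF : Fintype.card F = t ^ 2) (hσ : ∀ x, σ x = x ^ t)
    (hσσ : ∀ x, σ (σ x) = x) : #{x : F | x + σ x = 0} = t := by
  refine le_antisymm (card_trace_eq_zero_le ht hσ) ?_
  have hle : #(Finset.univ : Finset F) ≤
      #{x : F | x + σ x = 0} * #{x : F | σ x = x} := by
    refine Finset.card_le_mul_card_image_of_maps_to (f := fun x => x + σ x) ?_ _ ?_
    · intro x _
      simp [hσσ, add_comm]
    · intro b _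
      by_cases hb : ∃ x₀, x₀ + σ x₀ = b
      · obtain ⟨x₀, rfl⟩ := hb
        refine Finset.card_le_card_of_injOn (fun x => x - x₀) ?_ ?_
        · intro x hx
          simp only [coe_filter, mem_univ, true_and, Set.mem_ofPred_eq] at hx ⊢
          rw [map_sub]; linear_combination hx
        · intro x _ y _ h; simpa using h
      · rw [Finset.filter_false_of_mem]
        · simp
        · intro x _ h; exact hb ⟨x, h⟩
  rw [Finset.card_univ, hF] at hle
  have := card_fixed_le ht hσ
  nlinarith

theorem exists_trace_eq (ht : 1 < t) (hF : Fintype.card F = t ^ 2) (hσ : ∀ x, σ x = x ^ t)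
    (hσσ : ∀ x, σ (σ x) = x) {r : F} (hr : σ r = r) : ∃ x, x + σ x = r := by
  have : ∃ θ : F, θ + σ θ ≠ 0 := by
    by_contra! h
    have h1 := card_trace_eq_zero_le ht hσ
    rw [Finset.filter_true_of_mem (fun x _ => h x), Finset.card_univ, hF] at h1
    nlinarith
  obtain ⟨θ, hθ⟩ := this
  refine ⟨r * θ / (θ + σ θ), ?_⟩
  rw [map_div₀, map_mul, map_add, hσσ, hr, add_comm (σ θ) θ]
  field_simp

theorem card_affine_trace_eq_zero (ht : 1 < t) (hF : Fintype.card F = t ^ 2)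
    (hσ : ∀ x, σ x = x ^ t) (hσσ : ∀ x, σ (σ x) = x) {u : F} (hu : u ≠ 0) (v : F) :
    #{x : F | (x * u + v) + σ (x * u + v) = 0} = t := by
  rw [← card_trace_eq_zero ht hF hσ hσσ]
  refine Finset.card_bijective (fun x => x * u + v) ?_ (by simp)
  exact (Equiv.addRight v).bijective.comp (Equiv.mulRight₀ u hu).bijective

theorem card_trace_linear_eq_zero (ht : 1 < t) (hF : Fintype.card F = t ^ 2)
    (hσ : ∀ x, σ x = x ^ t) (hσσ : ∀ x, σ (σ x) = x) {u : F × F} (hu : u ≠ 0) :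
    #{x : F × F | (x.1 * u.1 + x.2 * u.2) + σ (x.1 * u.1 + x.2 * u.2) = 0} = t ^ 3 := by
  have key : ∀ u : F × F, u.1 ≠ 0 →
      #{x : F × F | (x.1 * u.1 + x.2 * u.2) + σ (x.1 * u.1 + x.2 * u.2) = 0} = t ^ 3 := by
    intro u hu
    rw [card_filter_prod]
    simp only [card_affine_trace_eq_zero ht hF hσ hσσ hu]
    simp [hF]; ring
  by_cases h1 : u.1 = 0
  · have h2 : u.2 ≠ 0 := fun h2 => hu (Prod.ext h1 h2)
    rw [← key u.swap h2]
    refine Finset.card_bijective Prod.swap Prod.swap_bijective ?_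
    intro x
    simp [add_comm]
  · exact key u h1

theorem card_trace_linear_inter_affine_le (ht : 1 < t) (hσ : ∀ x, σ x = x ^ t) {p r u v : F}
    (g : F) (h : p * v - r * u ≠ 0) :
    #{x : F × F | (x.1 * u + x.2 * v) + σ (x.1 * u + x.2 * v) = 0 ∧
      p * x.1 + r * x.2 + g = 0} ≤ t := by
  refine le_trans ?_ (card_trace_eq_zero_le ht hσ)
  refine Finset.card_le_card_of_injOn (fun x => x.1 * u + x.2 * v) ?_ ?_
  · intro x hx
    simp only [coe_filter, mem_univ, true_and, Set.mem_ofPred_eq] at hx ⊢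
    exact hx.1
  · rintro ⟨x, y⟩ hx ⟨x', y'⟩ hx' e
    simp only [coe_filter, mem_univ, true_and, Set.mem_ofPred_eq] at hx hx' e
    have e2 := hx.2.trans hx'.2.symm
    refine Prod.ext ?_ ?_
    · refine sub_eq_zero.mp ((mul_eq_zero.mp ?_).resolve_left h)
      show (p * v - r * u) * (x - x') = 0
      linear_combination v * e2 - r * e
    · refine sub_eq_zero.mp ((mul_eq_zero.mp ?_).resolve_left h)
      show (p * v - r * u) * (y - y') = 0
      linear_combination p * e - u * e2

end trace

section rankOne

variable {F : Type} [Field F]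

theorem map_pair_ne_zero {σ : F →+* F} {y : F × F} (hy : y ≠ 0) : (σ y.1, σ y.2) ≠ 0 := by
  intro h
  rw [Prod.mk_eq_zero, map_eq_zero, map_eq_zero] at h
  exact hy (Prod.ext h.1 h.2)

theorem exists_rank_one {m₁ m₂ m₃ m₄ : F} (h : ¬ (m₁ = 0 ∧ m₂ = 0 ∧ m₃ = 0 ∧ m₄ = 0))
    (hdet : m₁ * m₄ - m₂ * m₃ = 0) : ∃ μ ν φ ψ : F, ¬ (μ = 0 ∧ ν = 0) ∧ ¬ (φ = 0 ∧ ψ = 0) ∧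
      m₁ = μ * φ ∧ m₂ = μ * ψ ∧ m₃ = ν * φ ∧ m₄ = ν * ψ := by
  by_cases h1 : m₁ = 0
  · by_cases h2 : m₂ = 0
    · exact ⟨0, 1, m₃, m₄, by simp, fun h' => h ⟨h1, h2, h'⟩, by simp [h1], by simp [h2],
        by simp, by simp⟩
    · refine ⟨1, m₄ / m₂, m₁, m₂, by simp, by simp [h2], by simp, by simp, ?_, ?_⟩
      · field_simp; linear_combination -hdet
      · field_simp
  · refine ⟨1, m₃ / m₁, m₁, m₂, by simp, by simp [h1], by simp, by simp, ?_, ?_⟩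
    · field_simp
    · field_simp; linear_combination hdet

end rankOne

section sections

variable {F : Type} [Field F] [Fintype F] [DecidableEq F] {t : ℕ} {σ : F →+* F}

theorem card_sesquilinear_eq_zero_le (ht : 1 < t) (hσ : ∀ x, σ x = x ^ t) {m₁ m₂ m₃ m₄ : F}
    (h : ¬ (m₁ = 0 ∧ m₂ = 0 ∧ m₃ = 0 ∧ m₄ = 0)) :
    (#{y : F × F | y ≠ 0 ∧ (m₁ * y.1 + m₂ * y.2) * σ y.2 - (m₃ * y.1 + m₄ * y.2) * σ y.1 = 0} : ℤ)
      ≤ (t + 2) * (Fintype.card F - 1) := by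
  rw [card_filter_prod, ← Finset.add_sum_erase _ _ (Finset.mem_univ 0)]
  have h0 : #{a : F | (a, (0 : F)) ≠ 0 ∧ (m₁ * (a, (0 : F)).1 + m₂ * (a, (0 : F)).2) *
      σ (a, (0 : F)).2 - (m₃ * (a, (0 : F)).1 + m₄ * (a, (0 : F)).2) * σ (a, (0 : F)).1 = 0}
      ≤ Fintype.card F - 1 := by
    rw [← Finset.card_univ, ← Finset.card_erase_of_mem (Finset.mem_univ (0 : F))]
    refine Finset.card_le_card ?_
    intro x hx
    simp only [mem_filter, mem_univ, true_and] at hx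
    simp only [mem_erase, mem_univ, and_true]
    rintro rfl
    exact hx.1 rfl
  have h1 : ∀ b ∈ Finset.univ.erase (0 : F),
      #{a : F | (a, b) ≠ 0 ∧ (m₁ * (a, b).1 + m₂ * (a, b).2) *
      σ (a, b).2 - (m₃ * (a, b).1 + m₄ * (a, b).2) * σ (a, b).1 = 0} ≤ t + 1 := by
    intro b hb
    have hb0 : b ≠ 0 := by simpa using hb
    have hb1 : b ^ t ≠ 0 := pow_ne_zero _ hb0
    have e1 : (1 : ℕ) ≠ t + 1 := by lia
    have e2 : t ≠ t + 1 := by lia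
    have e3 : (0 : ℕ) ≠ t := by lia
    open Polynomial in
    have hP : (C (-m₃) * X ^ (t + 1) + C (-m₄ * b) * X ^ t + C (m₁ * b ^ t) * X +
        C (m₂ * b * b ^ t) : F[X]) ≠ 0 := by
      intro hP
      have c0 := congrArg (fun p => p.coeff 0) hP
      have c1 := congrArg (fun p => p.coeff 1) hP
      have c2 := congrArg (fun p => p.coeff t) hP
      have c3 := congrArg (fun p => p.coeff (t + 1)) hP
      simp only [coeff_add, coeff_C_mul, coeff_X_pow, coeff_C, coeff_X, coeff_zero] at c0 c1 c2 c3
      simp [e3, e3.symm, ht.ne, hb0] at c0 c1 c2 c3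
      have hm4 := c2
      exact h ⟨c1, c0, c3, hm4⟩
    refine le_trans ?_ ((card_roots_le _ hP).trans ?_)
    · refine Finset.card_le_card ?_
      intro x hx
      simp only [mem_filter, mem_univ, true_and, hσ] at hx ⊢
      simp only [Polynomial.eval_add, Polynomial.eval_mul, Polynomial.eval_C, Polynomial.eval_pow,
        Polynomial.eval_X]
      linear_combination hx.2
    · compute_degree!
  have h2 := Finset.sum_le_card_nsmul _ _ _ h1
  rw [Finset.card_erase_of_mem (Finset.mem_univ _), Finset.card_univ] at h2
  have hq : 0 < Fintype.card F := Fintype.card_pos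
  zify [show 1 ≤ Fintype.card F from hq] at h0 h2 ⊢
  rw [nsmul_eq_mul] at h2
  push_cast [Nat.cast_sub (show 1 ≤ Fintype.card F from hq)] at h0 h2 ⊢
  linarith

theorem sum_le_of_le_add_ite (hF : Fintype.card F = t ^ 2) (z : F × F → ℕ)
    (A A' : Finset (F × F)) {a b b' : ℤ} (hb : 0 ≤ b) (hb' : 0 ≤ b') (h0 : z 0 ≤ t ^ 4)
    (h : ∀ y ≠ 0, (z y : ℤ) ≤ a + (if y ∈ A then b else 0) + (if y ∈ A' then b' else 0)) :
    ((∑ y, z y : ℕ) : ℤ) ≤ t ^ 4 + (t ^ 4 - 1) * a + #A * b + #A' * b' := by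
  have aux : ∀ (B : Finset (F × F)) (c : ℤ), 0 ≤ c →
      ∑ y ∈ Finset.univ.erase (0 : F × F), (if y ∈ B then c else 0) ≤ #B * c := by
    intro B c hc
    rw [← Finset.sum_filter, Finset.sum_const, nsmul_eq_mul]
    refine mul_le_mul_of_nonneg_right ?_ hc
    exact_mod_cast Finset.card_le_card (fun x hx => (Finset.mem_filter.mp hx).2)
  rw [← Finset.add_sum_erase _ _ (Finset.mem_univ 0)]
  push_cast
  have h1 := Finset.sum_le_sum (s := Finset.univ.erase (0 : F × F))
    (fun y hy => h y (Finset.ne_of_mem_erase hy))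
  rw [Finset.sum_add_distrib, Finset.sum_add_distrib, Finset.sum_const,
    Finset.card_erase_of_mem (Finset.mem_univ _), Finset.card_univ, Fintype.card_prod, hF,
    nsmul_eq_mul] at h1
  have ht : 1 ≤ t ^ 2 * t ^ 2 := by
    rw [← hF]; exact Nat.mul_pos Fintype.card_pos Fintype.card_pos
  rw [Nat.cast_sub ht] at h1
  push_cast at h1
  have h2 := aux A b hb
  have h3 := aux A' b' hb'
  zify at h0
  linarith

theorem card_ne_zero_and (P : F × F → Prop) [DecidablePred P] (h : P 0) :
    (#{y : F × F | y ≠ 0 ∧ P y} : ℤ) = #{y : F × F | P y} - 1 := by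
  have : ({y : F × F | y ≠ 0 ∧ P y} : Finset _) = ({y : F × F | P y} : Finset _).erase 0 := by
    ext y; simp
  rw [this, Finset.card_erase_of_mem (by simpa using h),
    Nat.cast_sub (Finset.card_pos.mpr ⟨0, by simpa using h⟩)]
  simp

/-- A quadric containing the generator `y = 0` of the Hermitian surface
`Tr (x₁ ȳ₁ + x₂ ȳ₂) = 0`. -/
theorem card_le_of_vanishing_on_generator (ht : 1 < t) (hF : Fintype.card F = t ^ 2)
    (hσ : ∀ x, σ x = x ^ t) (hσσ : ∀ x, σ (σ x) = x) {m₁ m₂ m₃ m₄ c₁ c₂ c₃ : F}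
    (h : ¬ (m₁ = 0 ∧ m₂ = 0 ∧ m₃ = 0 ∧ m₄ = 0 ∧ c₁ = 0 ∧ c₂ = 0 ∧ c₃ = 0)) :
    (#{p : (F × F) × (F × F) | (p.1.1 * σ p.2.1 + p.1.2 * σ p.2.2) +
        σ (p.1.1 * σ p.2.1 + p.1.2 * σ p.2.2) = 0 ∧
      (m₁ * p.2.1 + m₂ * p.2.2) * p.1.1 + (m₃ * p.2.1 + m₄ * p.2.2) * p.1.2 +
        (c₁ * p.2.1 ^ 2 + c₂ * (p.2.1 * p.2.2) + c₃ * p.2.2 ^ 2) = 0} : ℤ) ≤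
      (t ^ 2 - 1) * (2 * t ^ 3 + 2 * t ^ 2 - t + 1) + 1 := by
  rw [card_filter_prod]
  dsimp only
  set z : F × F → ℕ := fun y => #{x : F × F | (x.1 * σ y.1 + x.2 * σ y.2) +
        σ (x.1 * σ y.1 + x.2 * σ y.2) = 0 ∧
      (m₁ * y.1 + m₂ * y.2) * x.1 + (m₃ * y.1 + m₄ * y.2) * x.2 +
        (c₁ * y.1 ^ 2 + c₂ * (y.1 * y.2) + c₃ * y.2 ^ 2) = 0} with hz
  have z0 : z 0 ≤ t ^ 4 := by
    refine (Finset.card_le_univ _).trans (le_of_eq ?_)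
    rw [Fintype.card_prod, hF]; ring
  have z3 : ∀ y ≠ 0, z y ≤ t ^ 3 := by
    intro y hy
    rw [← card_trace_linear_eq_zero ht hF hσ hσσ (map_pair_ne_zero (σ := σ) hy)]
    refine Finset.card_le_card fun x hx => ?_
    simp only [mem_filter, mem_univ, true_and] at hx ⊢
    exact hx.1
  have z2 : ∀ y, ¬ (m₁ * y.1 + m₂ * y.2 = 0 ∧ m₃ * y.1 + m₄ * y.2 = 0) → z y ≤ t ^ 2 := by
    intro y hy
    rw [← hF]
    refine le_trans (Finset.card_le_card fun x hx => ?_) (card_affine_le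
      (c₁ * y.1 ^ 2 + c₂ * (y.1 * y.2) + c₃ * y.2 ^ 2) hy)
    simp only [mem_filter, mem_univ, true_and] at hx ⊢
    exact hx.2
  have z1 : ∀ y, (m₁ * y.1 + m₂ * y.2) * σ y.2 - (m₃ * y.1 + m₄ * y.2) * σ y.1 ≠ 0 →
      z y ≤ t := fun y hy => card_trace_linear_inter_affine_le ht hσ _ hy
  have t1 : (1 : ℤ) < t := by exact_mod_cast ht
  have tt : (0 : ℤ) ≤ t ^ 2 - t := by nlinarith
  have ttt : (0 : ℤ) ≤ t ^ 3 - t := by nlinarith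
  by_cases hm : m₁ = 0 ∧ m₂ = 0 ∧ m₃ = 0 ∧ m₄ = 0
  · have hc : ¬ (c₁ = 0 ∧ c₂ = 0 ∧ c₃ = 0) := by tauto
    have hA := card_ne_zero_and
      (fun y : F × F => c₁ * y.1 ^ 2 + c₂ * (y.1 * y.2) + c₃ * y.2 ^ 2 = 0) (by simp)
    have hA' := card_binary_quadratic_lt hc
    rw [hF] at hA'
    zify at hA'
    have := sum_le_of_le_add_ite hF z
      ({y : F × F | y ≠ 0 ∧ c₁ * y.1 ^ 2 + c₂ * (y.1 * y.2) + c₃ * y.2 ^ 2 = 0} : Finset _) ∅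
      (a := 0) (b := t ^ 3) (b' := 0) (by positivity) le_rfl z0 (by
        intro y hy
        by_cases hc0 : c₁ * y.1 ^ 2 + c₂ * (y.1 * y.2) + c₃ * y.2 ^ 2 = 0
        · have := z3 y hy
          zify at this
          simpa [hy, hc0] using this
        · simp [hz, hm, hc0])
    rw [hA] at this
    have h5 := mul_le_mul_of_nonneg_right
      (show ((#{y : F × F | c₁ * y.1 ^ 2 + c₂ * (y.1 * y.2) + c₃ * y.2 ^ 2 = 0} : ℤ) - 1) ≤
        2 * t ^ 2 - 2 by linarith) (show (0 : ℤ) ≤ (t : ℤ) ^ 3 by positivity)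
    have h6 := mul_nonneg (show (0 : ℤ) ≤ (t : ℤ) ^ 2 - 1 by nlinarith) tt
    linarith
  by_cases hdet : m₁ * m₄ - m₂ * m₃ = 0
  · obtain ⟨μ, ν, φ, ψ, hμ, hφ, e1, e2, e3, e4⟩ := exists_rank_one hm hdet
    have hA := card_ne_zero_and (fun y : F × F => φ * y.1 + ψ * y.2 + 0 = 0) (by simp)
    have hA1 := card_affine_le 0 hφ
    have hB := card_ne_zero_and (fun y : F × F => -σ ν * y.1 + σ μ * y.2 + 0 = 0) (by simp)
    have hB1 := card_affine_le (α := - σ ν) (β := σ μ) 0 (by simpa [and_comm] using hμ)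
    rw [hF] at hA1 hB1
    zify at hA1 hB1
    have := sum_le_of_le_add_ite hF z
      ({y : F × F | y ≠ 0 ∧ φ * y.1 + ψ * y.2 + 0 = 0} : Finset _)
      ({y : F × F | y ≠ 0 ∧ -σ ν * y.1 + σ μ * y.2 + 0 = 0} : Finset _)
      (a := t) (b := t ^ 3 - t) (b' := t ^ 2 - t) ttt tt z0 (by
        intro y hy
        simp only [mem_filter, mem_univ, true_and, hy, ne_eq, not_false_eq_true]
        by_cases h1 : φ * y.1 + ψ * y.2 + 0 = 0
        · have := z3 y hy
          zify at this
          rw [if_pos h1]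
          split_ifs <;> linarith
        rw [if_neg h1]
        by_cases h2 : -σ ν * y.1 + σ μ * y.2 + 0 = 0
        · have := z2 y (by
            rintro ⟨h3, h4⟩
            have h5 : μ * (φ * y.1 + ψ * y.2 + 0) = 0 := by
              linear_combination h3 - y.1 * e1 - y.2 * e2
            have h6 : ν * (φ * y.1 + ψ * y.2 + 0) = 0 := by
              linear_combination h4 - y.1 * e3 - y.2 * e4
            exact hμ ⟨(mul_eq_zero.mp h5).resolve_right h1, (mul_eq_zero.mp h6).resolve_right h1⟩)
          zify at this
          rw [if_pos h2]
          linarith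
        · have := z1 y (by
            intro h3
            have h4 : (φ * y.1 + ψ * y.2 + 0) * (-ν * σ y.1 + μ * σ y.2) = 0 := by
              rw [e1, e2, e3, e4] at h3
              linear_combination h3
            have h5 := congrArg σ ((mul_eq_zero.mp h4).resolve_left h1)
            apply h2
            simpa [hσσ] using h5)
          zify at this
          rw [if_neg h2]
          linarith)
    rw [hA, hB] at this
    have h5 := mul_le_mul_of_nonneg_right
      (show ((#{y : F × F | φ * y.1 + ψ * y.2 + 0 = 0} : ℤ) - 1) ≤ t ^ 2 - 1 by linarith) ttt
    have h6 := mul_le_mul_of_nonneg_right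
      (show ((#{y : F × F | -σ ν * y.1 + σ μ * y.2 + 0 = 0} : ℤ) - 1) ≤ t ^ 2 - 1 by linarith) tt
    linarith
  · have hA := card_sesquilinear_eq_zero_le ht hσ hm
    rw [hF] at hA
    push_cast at hA
    have := sum_le_of_le_add_ite hF z
      ({y : F × F | y ≠ 0 ∧ (m₁ * y.1 + m₂ * y.2) * σ y.2 - (m₃ * y.1 + m₄ * y.2) * σ y.1 = 0} :
        Finset _) ∅ (a := t) (b := t ^ 2 - t) (b' := 0) tt le_rfl z0 (by
        intro y hy
        simp only [mem_filter, mem_univ, true_and, hy, ne_eq, not_false_eq_true]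
        by_cases h1 : (m₁ * y.1 + m₂ * y.2) * σ y.2 - (m₃ * y.1 + m₄ * y.2) * σ y.1 = 0
        · rw [if_pos h1]
          have := z2 y (by
            rintro ⟨h3, h4⟩
            apply hy
            refine Prod.ext ?_ ?_
            · refine (mul_eq_zero.mp (?_ : (m₁ * m₄ - m₂ * m₃) * y.1 = 0)).resolve_left hdet
              linear_combination m₄ * h3 - m₂ * h4
            · refine (mul_eq_zero.mp (?_ : (m₁ * m₄ - m₂ * m₃) * y.2 = 0)).resolve_left hdet
              linear_combination m₁ * h4 - m₃ * h3)
          zify at this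
          simp; linarith
        · have := z1 y h1
          zify at this
          rw [if_neg h1]
          simp; linarith)
    have h5 := mul_le_mul_of_nonneg_right hA tt
    linarith

/-- A quadric not containing any generator of the Hermitian surface
`Tr (x₁ ȳ₁ + x₂ ȳ₂) = 0`, with the lines through the points of `y = 0` parametrized. -/
theorem card_le_of_lines (ht : 1 < t) (hF : Fintype.card F = t ^ 2)
    (hσ : ∀ x, σ x = x ^ t) (g : (F × F) × (F × F) → F)
    (h0 : #{x : F × F | g (x, 0) = 0} < 2 * Fintype.card F)
    (h : ∀ x y : F × F, y ≠ 0 →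
      (x.1 * σ y.1 + x.2 * σ y.2) + σ (x.1 * σ y.1 + x.2 * σ y.2) = 0 →
      #{l : F | g ((x.1 - l * σ y.2, x.2 + l * σ y.1), y) = 0} ≤ 2) :
    (#{p : (F × F) × (F × F) | (p.1.1 * σ p.2.1 + p.1.2 * σ p.2.2) +
        σ (p.1.1 * σ p.2.1 + p.1.2 * σ p.2.2) = 0 ∧ g p = 0} : ℤ) ≤
      (t ^ 2 - 1) * (2 * t ^ 3 + 2 * t ^ 2 - t + 1) + 1 := by
  rw [card_filter_prod, ← Finset.add_sum_erase _ _ (Finset.mem_univ 0)]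
  dsimp only
  have h1 : ∀ y ∈ Finset.univ.erase (0 : F × F),
      #{x : F × F | (x.1 * σ y.1 + x.2 * σ y.2) + σ (x.1 * σ y.1 + x.2 * σ y.2) = 0 ∧
        g (x, y) = 0} ≤ 2 * t := by
    intro y hy
    have hy0 : y ≠ 0 := Finset.ne_of_mem_erase hy
    refine le_trans (Finset.card_le_mul_card_image_of_maps_to
      (f := fun x : F × F => x.1 * σ y.1 + x.2 * σ y.2)
      (t := ({s : F | s + σ s = 0} : Finset F)) ?_ 2 ?_)
      (Nat.mul_le_mul_left 2 (card_trace_eq_zero_le ht hσ))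
    · intro x hx
      simp only [mem_filter, mem_univ, true_and] at hx ⊢
      exact hx.1
    · intro s hs
      rcases Finset.eq_empty_or_nonempty ({a ∈ ({x : F × F | (x.1 * σ y.1 + x.2 * σ y.2) +
        σ (x.1 * σ y.1 + x.2 * σ y.2) = 0 ∧ g (x, y) = 0} : Finset _) |
          a.1 * σ y.1 + a.2 * σ y.2 = s}) with he | ⟨x₀, hx₀⟩
      · rw [he]; simp
      · simp only [mem_filter, mem_univ, true_and] at hx₀
        refine le_trans ?_ (h x₀ y hy0 hx₀.1.1)
        refine le_trans (Finset.card_le_card ?_) (Finset.card_image_le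
          (f := fun l : F => (x₀.1 - l * σ y.2, x₀.2 + l * σ y.1)))
        intro x hx
        simp only [mem_filter, mem_univ, true_and] at hx
        have hxl : ∃ l : F, (x₀.1 - l * σ y.2, x₀.2 + l * σ y.1) = x := by
          have e := hx.2.trans hx₀.2.symm
          by_cases hy1 : σ y.1 = 0
          · have hy2 : σ y.2 ≠ 0 := fun hy2 => map_pair_ne_zero (σ := σ) hy0 (Prod.ext hy1 hy2)
            refine ⟨(x₀.1 - x.1) / σ y.2, Prod.ext ?_ ?_⟩
            · field_simp; ring
            · rw [hy1] at e ⊢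
              refine mul_right_cancel₀ hy2 ?_
              linear_combination -e
          · refine ⟨(x.2 - x₀.2) / σ y.1, Prod.ext ?_ ?_⟩
            · refine mul_right_cancel₀ hy1 ?_
              field_simp
              linear_combination -e
            · field_simp; ring
        obtain ⟨l, rfl⟩ := hxl
        refine Finset.mem_image_of_mem _ ?_
        simpa using hx.1.2
  have h2 := Finset.sum_le_card_nsmul _ _ _ h1
  rw [Finset.card_erase_of_mem (Finset.mem_univ _), Finset.card_univ, Fintype.card_prod, hF,
    nsmul_eq_mul] at h2
  have h3 : #{x : F × F | (x.1 * σ (0 : F × F).1 + x.2 * σ (0 : F × F).2) +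
      σ (x.1 * σ (0 : F × F).1 + x.2 * σ (0 : F × F).2) = 0 ∧ g (x, 0) = 0} < 2 * t ^ 2 := by
    rw [← hF]; refine lt_of_le_of_lt (Finset.card_le_card fun x hx => ?_) h0
    simp only [mem_filter, mem_univ, true_and] at hx ⊢
    exact hx.2
  have ht2 : 1 ≤ t ^ 2 * t ^ 2 := by
    rw [← hF]; exact Nat.mul_pos Fintype.card_pos Fintype.card_pos
  rw [Nat.cast_id] at h2
  zify [ht2] at h2 h3
  push_cast
  have t1 : (2 : ℤ) ≤ t := by exact_mod_cast ht
  have h6 := mul_nonneg (show (0 : ℤ) ≤ (t : ℤ) ^ 2 - 1 by nlinarith)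
    (show (0 : ℤ) ≤ 2 * (t : ℤ) ^ 2 - 3 * t - 1 by nlinarith)
  linarith

end sections

section exactCounts

variable {F : Type} [Field F] [Fintype F] [DecidableEq F] {t : ℕ} {σ : F →+* F}

theorem card_hyperbolic_isotropic (ht : 1 < t) (hF : Fintype.card F = t ^ 2)
    (hσ : ∀ x, σ x = x ^ t) (hσσ : ∀ x, σ (σ x) = x) :
    (#{p : (F × F) × (F × F) | (p.1.1 * σ p.2.1 + p.1.2 * σ p.2.2) +
        σ (p.1.1 * σ p.2.1 + p.1.2 * σ p.2.2) = 0} : ℤ) = t ^ 7 + t ^ 4 - t ^ 3 := by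
  rw [card_filter_prod, ← Finset.add_sum_erase _ _ (Finset.mem_univ 0)]
  dsimp only
  rw [Finset.sum_congr rfl (fun y hy => card_trace_linear_eq_zero ht hF hσ hσσ
    (map_pair_ne_zero (σ := σ) (Finset.ne_of_mem_erase hy)))]
  have ht2 : 1 ≤ t ^ 2 * t ^ 2 := by
    rw [← hF]; exact Nat.mul_pos Fintype.card_pos Fintype.card_pos
  simp only [Prod.fst_zero, Prod.snd_zero, map_zero, mul_zero, add_zero, Finset.filter_true,
    Finset.card_univ, Finset.sum_const, Finset.card_erase_of_mem (Finset.mem_univ _),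
    Fintype.card_prod, hF, smul_eq_mul]
  push_cast [Nat.cast_sub ht2]
  ring

theorem card_mul_eq_zero :
    (#{x : F × F | x.1 * x.2 = 0} : ℤ) = 2 * Fintype.card F - 1 := by
  rw [card_filter_prod, ← Finset.add_sum_erase _ _ (Finset.mem_univ 0)]
  rw [Finset.sum_congr rfl (g := fun _ => 1)]
  · have : 1 ≤ Fintype.card F := Fintype.card_pos
    simp only [mul_zero, Finset.filter_true, Finset.card_univ, Finset.sum_const,
      Finset.card_erase_of_mem (Finset.mem_univ _), smul_eq_mul, mul_one]
    push_cast [Nat.cast_sub this]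
    ring
  · intro y hy
    have : y ≠ 0 := Finset.ne_of_mem_erase hy
    rw [Finset.card_eq_one]
    exact ⟨0, by ext; simp [this]⟩

theorem card_trace_mul_conj_eq_zero (ht : 1 < t) (hF : Fintype.card F = t ^ 2)
    (hσ : ∀ x, σ x = x ^ t) (hσσ : ∀ x, σ (σ x) = x) :
    (#{x : F × F | x.1 * σ x.2 + σ (x.1 * σ x.2) = 0} : ℤ) = t ^ 3 + t ^ 2 - t := by
  rw [card_filter_prod, ← Finset.add_sum_erase _ _ (Finset.mem_univ 0)]
  rw [Finset.sum_congr rfl (g := fun _ => t)]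
  · have : 1 ≤ t ^ 2 := hF ▸ Fintype.card_pos
    simp only [mul_zero, map_zero, add_zero, Finset.filter_true, Finset.card_univ,
      Finset.sum_const, Finset.card_erase_of_mem (Finset.mem_univ _), smul_eq_mul, hF]
    push_cast [Nat.cast_sub this]
    ring
  · intro y hy
    have : y ≠ 0 := Finset.ne_of_mem_erase hy
    simpa using card_affine_trace_eq_zero ht hF hσ hσσ (u := σ y) (by simpa using this) 0

theorem card_hyperbolic_isotropic_inter_planes (ht : 1 < t) (hF : Fintype.card F = t ^ 2)
    (hσ : ∀ x, σ x = x ^ t) (hσσ : ∀ x, σ (σ x) = x) :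
    (#{p : (F × F) × (F × F) | (p.1.1 * σ p.2.1 + p.1.2 * σ p.2.2) +
        σ (p.1.1 * σ p.2.1 + p.1.2 * σ p.2.2) = 0 ∧ p.1.1 * p.2.1 = 0} : ℤ) =
      (2 * t ^ 2 - 1) * (t ^ 3 + t ^ 2 - t) := by
  have h1 : #{p : (F × F) × (F × F) | (p.1.1 * σ p.2.1 + p.1.2 * σ p.2.2) +
        σ (p.1.1 * σ p.2.1 + p.1.2 * σ p.2.2) = 0 ∧ p.1.1 * p.2.1 = 0} =
      #(({x : F × F | x.1 * x.2 = 0} : Finset _) ×ˢ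
        ({x : F × F | x.1 * σ x.2 + σ (x.1 * σ x.2) = 0} : Finset _)) := by
    refine Finset.card_bijective (Equiv.prodProdProdComm F F F F)
      (Equiv.prodProdProdComm F F F F).bijective ?_
    rintro ⟨⟨x₁, x₂⟩, y₁, y₂⟩
    simp only [mem_filter, mem_univ, true_and, Equiv.prodProdProdComm_apply, mem_product]
    rw [and_comm]
    refine and_congr_right fun h => ?_
    have : x₁ * σ y₁ = 0 := by
      rcases mul_eq_zero.mp h with h | h <;> simp [h]
    rw [this, zero_add]
  rw [h1, Finset.card_product]
  push_cast
  rw [card_mul_eq_zero, card_trace_mul_conj_eq_zero ht hF hσ hσσ, hF]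
  push_cast
  ring

end exactCounts

section hermForm

variable {F : Type} [Field F]

/-- The standard Hermitian form `∑ vᵢ w̄ᵢ` on `F⁴`. -/
def hermForm (σ : F →+* F) (v w : Fin 4 → F) : F := ∑ i, v i * σ (w i)

variable {σ : F →+* F}

theorem hermForm_add_left (u v w : Fin 4 → F) :
    hermForm σ (u + v) w = hermForm σ u w + hermForm σ v w := by
  simp [hermForm, add_mul, Finset.sum_add_distrib]

theorem hermForm_smul_left (k : F) (v w : Fin 4 → F) :
    hermForm σ (k • v) w = k * hermForm σ v w := by
  simp [hermForm, mul_assoc, Finset.mul_sum]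

theorem hermForm_add_right (u v w : Fin 4 → F) :
    hermForm σ u (v + w) = hermForm σ u v + hermForm σ u w := by
  simp [hermForm, mul_add, Finset.sum_add_distrib]

theorem hermForm_smul_right (k : F) (v w : Fin 4 → F) :
    hermForm σ v (k • w) = σ k * hermForm σ v w := by
  simp [hermForm, Finset.mul_sum, mul_left_comm]

theorem map_hermForm (hσσ : ∀ x, σ (σ x) = x) (v w : Fin 4 → F) :
    σ (hermForm σ v w) = hermForm σ w v := by
  simp [hermForm, hσσ, mul_comm]

theorem eq_zero_of_hermForm_eq_zero {w : Fin 4 → F} (h : ∀ v, hermForm σ v w = 0) : w = 0 := by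
  ext i
  simpa [hermForm, Pi.single_apply] using h (Pi.single i 1)

/-- `hermForm` as a linear functional of its first argument. -/
def hermFunctional (σ : F →+* F) (w : Fin 4 → F) : (Fin 4 → F) →ₗ[F] F where
  toFun v := hermForm σ v w
  map_add' u v := hermForm_add_left u v w
  map_smul' k v := hermForm_smul_left k v w

/-- A basis made of two mutually orthogonal hyperbolic pairs `(a, c)` and `(b, d)`. -/
structure IsHyperbolicFrame (σ : F →+* F) (a b c d : Fin 4 → F) : Prop where
  aa : hermForm σ a a = 0
  bb : hermForm σ b b = 0
  cc : hermForm σ c c = 0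
  dd : hermForm σ d d = 0
  ab : hermForm σ a b = 0
  cd : hermForm σ c d = 0
  ac : hermForm σ a c = 1
  bd : hermForm σ b d = 1
  ad : hermForm σ a d = 0
  bc : hermForm σ b c = 0

/-- The vector with given coordinates in a hyperbolic frame. -/
def frameMap (a b c d : Fin 4 → F) (p : (F × F) × (F × F)) : Fin 4 → F :=
  p.1.1 • a + p.1.2 • b + p.2.1 • c + p.2.2 • d

theorem exists_hermForm_eq_one (hσσ : ∀ x, σ (σ x) = x) {a b : Fin 4 → F}
    (hab : ∀ x y : F, x • a + y • b = 0 → x = 0 ∧ y = 0) :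
    ∃ c, hermForm σ c a = 1 ∧ hermForm σ c b = 0 := by
  have : ∃ c, hermForm σ c b = 0 ∧ hermForm σ c a ≠ 0 := by
    by_contra! hcon
    have hle : LinearMap.ker (hermFunctional σ b) ≤ LinearMap.ker (hermFunctional σ a) :=
      fun v hv => hcon v hv
    have hmem : hermFunctional σ a ∈ Submodule.span F {hermFunctional σ b} := by
      simpa only [Set.range_const] using mem_span_of_iInf_ker_le_ker (ι := Unit)
        (L := fun _ => hermFunctional σ b) (K := hermFunctional σ a) (by simpa using hle)
    obtain ⟨k, hk⟩ := Submodule.mem_span_singleton.mp hmem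
    have h0 : (1 : F) • a + (-σ k) • b = 0 := by
      refine eq_zero_of_hermForm_eq_zero (σ := σ) fun v => ?_
      have hv : k * hermForm σ v b = hermForm σ v a := LinearMap.congr_fun hk v
      rw [hermForm_add_right, hermForm_smul_right, hermForm_smul_right, map_neg, hσσ, map_one, ← hv]
      ring
    exact one_ne_zero (hab _ _ h0).1
  obtain ⟨c, hb, ha⟩ := this
  exact ⟨(hermForm σ c a)⁻¹ • c, by rw [hermForm_smul_left, inv_mul_cancel₀ ha],
    by rw [hermForm_smul_left, hb, mul_zero]⟩

namespace IsHyperbolicFrame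

variable {a b c d : Fin 4 → F}

theorem conj_zero (hσσ : ∀ x, σ (σ x) = x) {v w : Fin 4 → F} (h : hermForm σ v w = 0) :
    hermForm σ w v = 0 := by
  rw [← map_hermForm hσσ, h, map_zero]

theorem conj_one (hσσ : ∀ x, σ (σ x) = x) {v w : Fin 4 → F} (h : hermForm σ v w = 1) :
    hermForm σ w v = 1 := by
  rw [← map_hermForm hσσ, h, map_one]

theorem hermForm_frameMap (hσσ : ∀ x, σ (σ x) = x) (H : IsHyperbolicFrame σ a b c d)
    (p p' : (F × F) × (F × F)) :
    hermForm σ (frameMap a b c d p) (frameMap a b c d p') =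
      p.1.1 * σ p'.2.1 + p.1.2 * σ p'.2.2 + (p.2.1 * σ p'.1.1 + p.2.2 * σ p'.1.2) := by
  simp only [frameMap, hermForm_add_left, hermForm_smul_left, hermForm_add_right,
    hermForm_smul_right, H.aa, H.bb, H.cc, H.dd, H.ab, H.cd, H.ac, H.bd, H.ad, H.bc,
    conj_zero hσσ H.ab, conj_zero hσσ H.cd, conj_one hσσ H.ac, conj_one hσσ H.bd,
    conj_zero hσσ H.ad, conj_zero hσσ H.bc]
  ring

theorem hermForm_frameMap_self (hσσ : ∀ x, σ (σ x) = x) (H : IsHyperbolicFrame σ a b c d)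
    (p : (F × F) × (F × F)) :
    hermForm σ (frameMap a b c d p) (frameMap a b c d p) =
      (p.1.1 * σ p.2.1 + p.1.2 * σ p.2.2) + σ (p.1.1 * σ p.2.1 + p.1.2 * σ p.2.2) := by
  rw [H.hermForm_frameMap hσσ]
  simp only [map_add, map_mul, hσσ]
  ring

theorem hermForm_frameMap_a (hσσ : ∀ x, σ (σ x) = x) (H : IsHyperbolicFrame σ a b c d)
    (p : (F × F) × (F × F)) : hermForm σ (frameMap a b c d p) a = p.2.1 := by
  simpa [frameMap] using H.hermForm_frameMap hσσ p ((1, 0), 0)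

theorem hermForm_frameMap_c (hσσ : ∀ x, σ (σ x) = x) (H : IsHyperbolicFrame σ a b c d)
    (p : (F × F) × (F × F)) : hermForm σ (frameMap a b c d p) c = p.1.1 := by
  simpa [frameMap] using H.hermForm_frameMap hσσ p (0, (1, 0))

theorem frameMap_injective (hσσ : ∀ x, σ (σ x) = x) (H : IsHyperbolicFrame σ a b c d) :
    Function.Injective (frameMap a b c d) := by
  intro p p' h
  have h1 := H.hermForm_frameMap_a hσσ p
  have h3 := H.hermForm_frameMap_c hσσ p
  have h2 : p.2.2 = p'.2.2 := by
    simpa [h, H.hermForm_frameMap hσσ] using (H.hermForm_frameMap hσσ p ((0, 1), 0)).symm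
  have h4 : p.1.2 = p'.1.2 := by
    simpa [h, H.hermForm_frameMap hσσ] using (H.hermForm_frameMap hσσ p (0, (0, 1))).symm
  rw [h, H.hermForm_frameMap_a hσσ] at h1
  rw [h, H.hermForm_frameMap_c hσσ] at h3
  exact Prod.ext (Prod.ext h3.symm h4) (Prod.ext h1.symm h2)

theorem frameMap_bijective [Finite F] (hσσ : ∀ x, σ (σ x) = x) (H : IsHyperbolicFrame σ a b c d) :
    Function.Bijective (frameMap a b c d) := by
  have := Fintype.ofFinite F
  classical
  refine (Fintype.bijective_iff_injective_and_card _).mpr ⟨H.frameMap_injective hσσ, ?_⟩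
  simp only [Fintype.card_prod, Fintype.card_pi, Finset.prod_const, Finset.card_univ,
    Fintype.card_fin]
  ring

end IsHyperbolicFrame

variable {t : ℕ}

theorem exists_isHyperbolicFrame [Fintype F] (ht : 1 < t) (hF : Fintype.card F = t ^ 2)
    (hσ : ∀ x, σ x = x ^ t) (hσσ : ∀ x, σ (σ x) = x) {a b : Fin 4 → F}
    (hab : ∀ x y : F, x • a + y • b = 0 → x = 0 ∧ y = 0) (aa : hermForm σ a a = 0)
    (bb : hermForm σ b b = 0) (ab : hermForm σ a b = 0) :
    ∃ c d, IsHyperbolicFrame σ a b c d := by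
  classical
  obtain ⟨c₀, hca, hcb⟩ := exists_hermForm_eq_one hσσ hab
  obtain ⟨d₀, hdb, hda⟩ := exists_hermForm_eq_one hσσ
    (a := b) (b := a) (fun x y h => (hab y x (by rwa [add_comm])).symm)
  obtain ⟨β, hβ⟩ := exists_trace_eq ht hF hσ hσσ (r := - hermForm σ d₀ d₀)
    (by rw [map_neg, map_hermForm hσσ])
  obtain ⟨α, hα⟩ := exists_trace_eq ht hF hσ hσσ (r := - hermForm σ c₀ c₀)
    (by rw [map_neg, map_hermForm hσσ])
  have hba := IsHyperbolicFrame.conj_zero hσσ ab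
  have hac := IsHyperbolicFrame.conj_one hσσ hca
  have hbc := IsHyperbolicFrame.conj_zero hσσ hcb
  have hbd := IsHyperbolicFrame.conj_one hσσ hdb
  have had := IsHyperbolicFrame.conj_zero hσσ hda
  refine ⟨c₀ + α • a + (-hermForm σ c₀ d₀) • b, d₀ + β • b, aa, bb, ?_, ?_, ab, ?_, ?_, ?_, ?_, ?_⟩
  all_goals simp only [hermForm_add_left, hermForm_smul_left, hermForm_add_right,
    hermForm_smul_right, aa, bb, ab, hba, hca, hcb, hdb, hac, hbc, hbd, had]
  · linear_combination hα
  · linear_combination hβ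
  all_goals ring

theorem exists_pow_add_one_eq_neg_one [Fintype F] (ht : 1 < t) (hF : Fintype.card F = t ^ 2)
    (hσ : ∀ x, σ x = x ^ t) : ∃ ε : F, ε ^ (t + 1) = -1 := by
  obtain ⟨g, hg⟩ := IsCyclic.exists_generator (α := Fˣ)
  have hord : orderOf g = (t + 1) * (t - 1) := by
    classical
    rw [orderOf_eq_card_of_forall_mem_zpowers hg, Nat.card_eq_fintype_card, Fintype.card_units, hF]
    obtain ⟨s, rfl⟩ := Nat.exists_eq_add_of_lt ht
    simp only [Nat.add_sub_cancel]
    rw [Nat.sub_eq_iff_eq_add (by nlinarith)]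
    ring_nf
  obtain ⟨k, hk⟩ := Subgroup.mem_zpowers_iff.mp (hg (-1))
  have hpow : ((-1 : Fˣ)) ^ (t - 1) = 1 := by
    have h1 : (-1 : F) ^ t = -1 := by rw [← hσ, map_neg, map_one]
    ext
    have h2 : (-1 : F) ^ (t - 1) * (-1) = 1 * (-1) := by
      rw [← pow_succ, Nat.sub_add_cancel ht.le, h1, one_mul]
    simpa using h2
  rw [← hk, ← zpow_natCast, ← zpow_mul, ← orderOf_dvd_iff_zpow_eq_one, hord] at hpow
  push_cast at hpow
  have hdvd : ((t : ℤ) + 1) ∣ k :=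
    Int.dvd_of_mul_dvd_mul_right (by lia) hpow
  obtain ⟨m, rfl⟩ := hdvd
  refine ⟨((g ^ m : Fˣ) : F), ?_⟩
  have : (g ^ m) ^ (t + 1) = (-1 : Fˣ) := by
    rw [← hk, ← zpow_natCast, ← zpow_mul]
    push_cast
    rw [mul_comm]
  rw [← Units.val_pow_eq_pow_val, this]
  simp

theorem exists_hyperbolicFrame [Fintype F] (ht : 1 < t) (hF : Fintype.card F = t ^ 2)
    (hσ : ∀ x, σ x = x ^ t) (hσσ : ∀ x, σ (σ x) = x) :
    ∃ a b c d, IsHyperbolicFrame σ a b c d := by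
  obtain ⟨ε, hε⟩ := exists_pow_add_one_eq_neg_one ht hF hσ
  have hε' : ε * σ ε = -1 := by rw [hσ, ← hε, pow_succ']
  obtain ⟨c, d, h⟩ := exists_isHyperbolicFrame ht hF hσ hσσ (a := ![1, ε, 0, 0])
    (b := ![0, 0, 1, ε]) (fun x y h => ⟨by simpa using congrFun h 0, by simpa using congrFun h 2⟩)
    (by simp [hermForm, Fin.sum_univ_four, hε']) (by simp [hermForm, Fin.sum_univ_four, hε'])
    (by simp [hermForm, Fin.sum_univ_four])
  exact ⟨_, _, c, d, h⟩

section bound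

variable [Fintype F] [DecidableEq F]

theorem card_isotropic (ht : 1 < t) (hF : Fintype.card F = t ^ 2)
    (hσ : ∀ x, σ x = x ^ t) (hσσ : ∀ x, σ (σ x) = x) :
    (#{v : Fin 4 → F | hermForm σ v v = 0} : ℤ) = t ^ 7 + t ^ 4 - t ^ 3 := by
  obtain ⟨a, b, c, d, H⟩ := exists_hyperbolicFrame ht hF hσ hσσ
  rw [← card_hyperbolic_isotropic ht hF hσ hσσ, Nat.cast_inj]
  refine (Finset.card_bijective (frameMap a b c d) (H.frameMap_bijective hσσ) fun p => ?_).symm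
  simp [H.hermForm_frameMap_self hσσ]

theorem card_zeros_on_line_le (B : LinearMap.BilinForm F (Fin 4 → F)) (v w : Fin 4 → F)
    (h : ∃ x y : F, B (x • v + y • w) (x • v + y • w) ≠ 0) :
    #{l : F | B (v + l • w) (v + l • w) = 0} ≤ 2 ∧
      #{x : F × F | B (x.1 • v + x.2 • w) (x.1 • v + x.2 • w) = 0} < 2 * Fintype.card F := by
  have hne : ¬ (B v v = 0 ∧ B v w + B w v = 0 ∧ B w w = 0) := by
    rintro ⟨h1, h2, h3⟩
    obtain ⟨x, y, h⟩ := h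
    apply h
    simp only [map_add, map_smul, LinearMap.add_apply, LinearMap.smul_apply, smul_eq_mul]
    linear_combination x ^ 2 * h1 + x * y * h2 + y ^ 2 * h3
  constructor
  · refine le_trans (le_of_eq ?_) (card_quadratic_le_two (α := B w w) (β := B v w + B w v)
      (γ := B v v) (by tauto))
    congr 1
    ext l
    simp only [mem_filter, mem_univ, true_and, map_add, map_smul, LinearMap.add_apply,
      LinearMap.smul_apply, smul_eq_mul]
    ring_nf
  · refine lt_of_le_of_lt (le_of_eq ?_) (card_binary_quadratic_lt hne)
    congr 1
    ext x
    simp only [mem_filter, mem_univ, true_and, map_add, map_smul, LinearMap.add_apply,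
      LinearMap.smul_apply, smul_eq_mul]
    ring_nf

theorem card_isotropic_inter_quadric_le (ht : 1 < t) (hF : Fintype.card F = t ^ 2)
    (hσ : ∀ x, σ x = x ^ t) (hσσ : ∀ x, σ (σ x) = x) (B : LinearMap.BilinForm F (Fin 4 → F))
    (hB : ∃ v, B v v ≠ 0) :
    (#{v : Fin 4 → F | hermForm σ v v = 0 ∧ B v v = 0} : ℤ) ≤
      (t ^ 2 - 1) * (2 * t ^ 3 + 2 * t ^ 2 - t + 1) + 1 := by
  have transport : ∀ {a b c d : Fin 4 → F}, IsHyperbolicFrame σ a b c d →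
      #{v : Fin 4 → F | hermForm σ v v = 0 ∧ B v v = 0} =
      #{p : (F × F) × (F × F) | (p.1.1 * σ p.2.1 + p.1.2 * σ p.2.2) +
        σ (p.1.1 * σ p.2.1 + p.1.2 * σ p.2.2) = 0 ∧
          B (frameMap a b c d p) (frameMap a b c d p) = 0} := by
    intro a b c d H
    refine (Finset.card_bijective (frameMap a b c d) (H.frameMap_bijective hσσ) fun p => ?_).symm
    simp only [mem_filter, mem_univ, true_and, H.hermForm_frameMap_self hσσ]
  by_cases hgen : ∃ a b c d, IsHyperbolicFrame σ a b c d ∧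
      ∀ x y : F, B (x • a + y • b) (x • a + y • b) = 0
  · obtain ⟨a, b, c, d, H, hab⟩ := hgen
    have haa : B a a = 0 := by simpa using hab 1 0
    have hbb : B b b = 0 := by simpa using hab 0 1
    have hba : B a b + B b a = 0 := by simpa [haa, hbb, add_comm] using hab 1 1
    have hexp : ∀ p, B (frameMap a b c d p) (frameMap a b c d p) =
        ((B a c + B c a) * p.2.1 + (B a d + B d a) * p.2.2) * p.1.1 +
        ((B b c + B c b) * p.2.1 + (B b d + B d b) * p.2.2) * p.1.2 +
        (B c c * p.2.1 ^ 2 + (B c d + B d c) * (p.2.1 * p.2.2) + B d d * p.2.2 ^ 2) := by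
      intro p
      simp only [frameMap, map_add, map_smul, LinearMap.add_apply,
        LinearMap.smul_apply, smul_eq_mul]
      linear_combination p.1.1 ^ 2 * haa + p.1.2 ^ 2 * hbb + p.1.1 * p.1.2 * hba
    rw [transport H]
    simp only [hexp]
    refine card_le_of_vanishing_on_generator ht hF hσ hσσ ?_
    rintro ⟨h1, h2, h3, h4, h5, h6, h7⟩
    obtain ⟨v, hv⟩ := hB
    obtain ⟨p, rfl⟩ := (H.frameMap_bijective hσσ).2 v
    apply hv
    rw [hexp, h1, h2, h3, h4, h5, h6, h7]
    ring
  · push Not at hgen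
    obtain ⟨a, b, c, d, H⟩ := exists_hyperbolicFrame ht hF hσ hσσ
    rw [transport H]
    refine card_le_of_lines ht hF hσ _ ?_ ?_
    · simpa [frameMap] using (card_zeros_on_line_le B a b (hgen a b c d H)).2
    · intro x y hy hx
      set v := frameMap a b c d (x, y) with hv
      set w := frameMap a b c d ((-σ y.2, σ y.1), 0) with hw
      have hline : ∀ l, frameMap a b c d ((x.1 - l * σ y.2, x.2 + l * σ y.1), y) = v + l • w := by
        intro l
        rw [hv, hw]
        simp only [frameMap, Prod.fst_zero, Prod.snd_zero]
        module
      simp only [hline]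
      refine (card_zeros_on_line_le B v w ?_).1
      obtain ⟨c', d', H'⟩ := exists_isHyperbolicFrame ht hF hσ hσσ (a := v) (b := w) (by
        intro α β h
        have h0 : frameMap a b c d ((α * x.1 - β * σ y.2, α * x.2 + β * σ y.1), α • y) =
            frameMap a b c d 0 := by
          have : frameMap a b c d 0 = 0 := by simp [frameMap]
          rw [this, ← h, hv, hw]
          simp only [frameMap, Prod.smul_fst, Prod.smul_snd, Prod.fst_zero, Prod.snd_zero,
            smul_eq_mul]
          module
        have h1 := H.frameMap_injective hσσ h0
        rw [Prod.mk_eq_zero, Prod.mk_eq_zero, smul_eq_zero] at h1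
        have hα : α = 0 := h1.2.resolve_right hy
        refine ⟨hα, ?_⟩
        by_contra hβ
        apply hy
        refine Prod.ext ?_ ?_
        · simpa [hα, hβ] using h1.1.2
        · simpa [hα, hβ] using h1.1.1)
        (by rw [hv, H.hermForm_frameMap_self hσσ]; exact hx)
        (by rw [hw, H.hermForm_frameMap_self hσσ]; simp)
        (by rw [hv, hw, H.hermForm_frameMap hσσ]; simp [hσσ]; ring)
      exact hgen v w c' d' H'

end bound

end hermForm

section projectivization

theorem card_vector_eq_card_point_mul {F : Type} [Field F] [Fintype F] [DecidableEq F] {n : ℕ}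
    (P : (Fin n → F) → Prop) [DecidablePred P] (hP : ∀ (u : Fˣ) v, P (u • v) ↔ P v) :
    #{v : Fin n → F | v ≠ 0 ∧ P v} =
      Nat.card {x : ℙ F (Fin n → F) // P x.rep} * (Fintype.card F - 1) := by
  rw [← Fintype.card_subtype, ← Fintype.card_units, ← Nat.card_eq_fintype_card,
    ← Nat.card_eq_fintype_card, ← Nat.card_prod]
  refine (Nat.card_congr (Equiv.ofBijective
    (fun y : {x : ℙ F (Fin n → F) // P x.rep} × Fˣ =>
      (⟨y.2 • y.1.1.rep, by simpa [Units.smul_def] using y.1.1.rep_nonzero,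
        (hP _ _).2 y.1.2⟩ : {v : Fin n → F // v ≠ 0 ∧ P v})) ⟨?_, ?_⟩)).symm
  · rintro ⟨⟨x, hx⟩, u⟩ ⟨⟨y, hy⟩, w⟩ h
    have h : u • x.rep = w • y.rep := congrArg Subtype.val h
    have hxy : x = y := by
      rw [← x.mk_rep, ← y.mk_rep, mk_eq_mk_iff]
      exact ⟨u⁻¹ * w, by rw [mul_smul, ← h, inv_smul_smul]⟩
    subst hxy
    have : (u : F) = w := smul_left_injective F x.rep_nonzero h
    simp [Units.ext this]
  · rintro ⟨v, hv, hPv⟩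
    obtain ⟨u, hu⟩ := exists_smul_eq_mk_rep F v hv
    exact ⟨⟨⟨mk F v hv, by rw [← hu]; exact (hP _ _).2 hPv⟩, u⁻¹⟩,
      Subtype.ext (by simp [← hu])⟩

end projectivization

section conjugation

variable {F : Type} [Field F] [Fintype F] {t : ℕ}

theorem exists_conjugation (ht : IsPrimePow t) (hF : Fintype.card F = t ^ 2) :
    ∃ σ : F →+* F, (∀ x, σ x = x ^ t) ∧ ∀ x, σ (σ x) = x := by
  obtain ⟨p, k, hp, hk, rfl⟩ := (isPrimePow_nat_iff _).1 ht
  obtain ⟨r, hr⟩ := CharP.exists F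
  obtain ⟨n, hrp, hn⟩ := FiniteField.card F r
  have hrp' : r = p := by
    have h : r ∣ (p ^ k) ^ 2 := hF ▸ hn ▸ dvd_pow_self r n.ne_zero
    exact (Nat.prime_dvd_prime_iff_eq hrp hp).1 (hrp.dvd_of_dvd_pow (hrp.dvd_of_dvd_pow h))
  subst hrp'
  have : Fact r.Prime := ⟨hrp⟩
  refine ⟨iterateFrobenius F r k, fun x => iterateFrobenius_def r k x, fun x => ?_⟩
  rw [iterateFrobenius_def, iterateFrobenius_def, ← pow_mul, ← sq, ← hF, FiniteField.pow_card]

end conjugation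

section quadraticForms

open MvPolynomial

variable {F : Type} [Field F]

theorem degree_eq_of_mem_support {n k : ℕ} {f : MvPolynomial (Fin n) F} (hf : f.IsHomogeneous k)
    {d : Fin n →₀ ℕ} (hd : d ∈ f.support) : d.degree = k := by
  rw [Finsupp.degree_eq_weight_one]
  exact hf (mem_support_iff.1 hd)

theorem exists_bilinForm_of_degree_eq_two (d : Fin 4 →₀ ℕ) (hd : d.degree = 2) (k : F) :
    ∃ B : LinearMap.BilinForm F (Fin 4 → F), ∀ v, eval v (monomial d k) = B v v := by
  obtain ⟨i, j, hij⟩ := Multiset.card_eq_two.1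
    (show d.toMultiset.card = 2 by rw [Finsupp.card_toMultiset, ← hd]; rfl)
  have hd' : d = Finsupp.single i 1 + Finsupp.single j 1 := by
    rw [← Finsupp.toMultiset_toFinsupp d, hij, Multiset.insert_eq_cons,
      ← Multiset.singleton_add, map_add, Multiset.toFinsupp_singleton, Multiset.toFinsupp_singleton]
  refine ⟨k • LinearMap.mk₂ F (fun v w : Fin 4 → F => v i * w j) ?_ ?_ ?_ ?_, fun v => ?_⟩
  · intros; simp [add_mul]
  · intros; simp [mul_assoc]
  · intros; simp [mul_add]
  · intros; simp [mul_left_comm]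
  · have h : monomial d k = C k * (X i * X j) := by
      rw [hd', X, X, monomial_mul, C_mul_monomial]; simp
    simp [h]

theorem exists_bilinForm_of_isHomogeneous {f : MvPolynomial (Fin 4) F} (hf : f.IsHomogeneous 2) :
    ∃ B : LinearMap.BilinForm F (Fin 4 → F), ∀ v, eval v f = B v v := by
  have key : ∀ s ⊆ f.support, ∃ B : LinearMap.BilinForm F (Fin 4 → F),
      ∀ v, eval v (∑ d ∈ s, monomial d (coeff d f)) = B v v := by
    intro s
    induction s using Finset.induction_on with
    | empty => exact fun _ => ⟨0, by simp⟩
    | insert d s hds ih =>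
      intro hs
      obtain ⟨B, hB⟩ := ih ((Finset.subset_insert d s).trans hs)
      obtain ⟨B', hB'⟩ := exists_bilinForm_of_degree_eq_two d
        (degree_eq_of_mem_support hf (hs (Finset.mem_insert_self d s))) (coeff d f)
      refine ⟨B' + B, fun v => ?_⟩
      rw [Finset.sum_insert hds, map_add, hB, hB']
      rfl
  obtain ⟨B, hB⟩ := key _ subset_rfl
  exact ⟨B, fun v => by rw [← hB, support_sum_monomial_coeff]⟩

theorem finrank_homogeneousSubmodule (n k : ℕ) :
    Module.finrank F (homogeneousSubmodule (Fin n) F k) = (n + k - 1).choose k := by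
  rw [homogeneousSubmodule_eq_finsupp_supported]
  refine (Module.finrank_eq_nat_card_basis
    (basisRestrictSupport F {d : Fin n →₀ ℕ | d.degree = k})).trans ?_
  have h : {d : Fin n →₀ ℕ | d.degree = k} =
      ((univ.finsuppAntidiag k : Finset (Fin n →₀ ℕ)) : Set (Fin n →₀ ℕ)) := by
    ext d
    simp [mem_finsuppAntidiag, Finsupp.degree_eq_sum]
  rw [h, Nat.card_coe_set_eq, Set.ncard_coe_finset, card_finsuppAntidiag_nat_eq_choose,
    card_univ, Fintype.card_fin]

theorem eval_smul_eq_zero_iff {f : MvPolynomial (Fin 4) F} (hf : f.IsHomogeneous 2)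
    (u : Fˣ) (v : Fin 4 → F) : eval (u • v) f = 0 ↔ eval v f = 0 := by
  obtain ⟨B, hB⟩ := exists_bilinForm_of_isHomogeneous hf
  simp [hB, Units.smul_def]

theorem eq_zero_of_eval_eq_zero_of_isHomogeneous [Fintype F] {t : ℕ} (ht : 1 < t)
    (hF : Fintype.card F = t ^ 2) {f : MvPolynomial (Fin 4) F} (hf : f.IsHomogeneous 2)
    (h : ∀ v, eval v f = 0) : f = 0 := by
  refine eq_zero_of_eval_eq_zero _ _ f h ((mem_restrictDegree _ _ _).2 fun d hd i => ?_)
  have := degree_eq_of_mem_support hf hd ▸ Finsupp.le_degree i d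
  have : 2 ^ 2 ≤ t ^ 2 := Nat.pow_le_pow_left ht 2
  lia

end quadraticForms

section weights

open MvPolynomial

variable {F : Type} [Field F] {t : ℕ} {σ : F →+* F}

theorem mem_hermSurf_iff (hσ : ∀ x, σ x = x ^ t) (x : ℙ F (Fin 4 → F)) :
    x ∈ hermSurf t F ↔ hermForm σ x.rep x.rep = 0 := by
  simp only [hermSurf, Set.mem_ofPred_eq, hermForm, hσ, pow_succ']

theorem hermForm_units_smul_eq_zero_iff (u : Fˣ) (v : Fin 4 → F) :
    hermForm σ (u • v) (u • v) = 0 ↔ hermForm σ v v = 0 := by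
  simp [Units.smul_def, hermForm_smul_left, hermForm_smul_right]

variable [Fintype F]

theorem card_hermSurf_mul [DecidableEq F] (hσ : ∀ x, σ x = x ^ t) :
    Nat.card (hermSurf t F) * (Fintype.card F - 1) + 1 =
      #{v : Fin 4 → F | hermForm σ v v = 0} := by
  have h := card_vector_eq_card_point_mul (fun v : Fin 4 → F => hermForm σ v v = 0)
    hermForm_units_smul_eq_zero_iff
  have h' : Nat.card (hermSurf t F) = Nat.card {x : ℙ F (Fin 4 → F) // hermForm σ x.rep x.rep = 0} :=
    Nat.card_congr (Equiv.subtypeEquivRight (mem_hermSurf_iff hσ))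
  have h0 : (0 : Fin 4 → F) ∈ ({v | hermForm σ v v = 0} : Finset (Fin 4 → F)) :=
    mem_filter.2 ⟨mem_univ _, by simp [hermForm]⟩
  rw [h', ← h, ← card_erase_add_one h0]
  congr 2
  ext v
  simp

theorem wt_hermEval_mul [DecidableEq F] (hσ : ∀ x, σ x = x ^ t) {f : MvPolynomial (Fin 4) F}
    (hf : f.IsHomogeneous 2) :
    wt t F (hermEval t F f) * (Fintype.card F - 1) +
        #{v : Fin 4 → F | hermForm σ v v = 0 ∧ eval v f = 0} =
      #{v : Fin 4 → F | hermForm σ v v = 0} := by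
  have h := card_vector_eq_card_point_mul
    (fun v : Fin 4 → F => hermForm σ v v = 0 ∧ ¬ eval v f = 0)
    fun u v => by rw [hermForm_units_smul_eq_zero_iff, eval_smul_eq_zero_iff hf]
  have h' : wt t F (hermEval t F f) =
      Nat.card {x : ℙ F (Fin 4 → F) // hermForm σ x.rep x.rep = 0 ∧ ¬ eval x.rep f = 0} :=
    Nat.card_congr ((Equiv.subtypeSubtypeEquivSubtypeInter (· ∈ hermSurf t F)
      (fun x => ¬ eval x.rep f = 0)).trans
        (Equiv.subtypeEquivRight fun x => by rw [mem_hermSurf_iff hσ]))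
  rw [h', ← h, ← card_filter_add_card_filter_not (s := {v : Fin 4 → F | hermForm σ v v = 0})
    (fun v => eval v f = 0), filter_filter, filter_filter, add_comm]
  congr 2
  ext v
  simp only [mem_filter, mem_univ, true_and, and_iff_right_iff_imp]
  rintro ⟨-, hv⟩ rfl
  obtain ⟨B, hB⟩ := exists_bilinForm_of_isHomogeneous hf
  exact hv (by rw [hB, map_zero])

theorem le_wt_hermEval (ht : 1 < t) (hF : Fintype.card F = t ^ 2) (hσ : ∀ x, σ x = x ^ t)
    (hσσ : ∀ x, σ (σ x) = x) {f : MvPolynomial (Fin 4) F} (hf : f.IsHomogeneous 2) (hf0 : f ≠ 0) :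
    (t ^ 5 - t ^ 3 - t ^ 2 + t : ℤ) ≤ wt t F (hermEval t F f) := by
  classical
  obtain ⟨B, hB⟩ := exists_bilinForm_of_isHomogeneous hf
  have hB0 : ∃ v, B v v ≠ 0 := by
    by_contra! h
    exact hf0 (eq_zero_of_eval_eq_zero_of_isHomogeneous ht hF hf fun v => by rw [hB, h])
  have hle := card_isotropic_inter_quadric_le ht hF hσ hσσ B hB0
  have hall := card_isotropic ht hF hσ hσσ
  have hw := wt_hermEval_mul hσ hf
  simp only [hB] at hw
  have hpos : 1 ≤ t ^ 2 := Nat.one_le_pow _ _ (by lia)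
  rw [hF] at hw
  zify [hpos] at hw
  have ht' : (1 : ℤ) < t := by exact_mod_cast ht
  have hq : (0 : ℤ) < t ^ 2 - 1 := by nlinarith
  refine le_of_mul_le_mul_right ?_ hq
  linarith

theorem exists_wt_hermEval_eq (ht : 1 < t) (hF : Fintype.card F = t ^ 2) (hσ : ∀ x, σ x = x ^ t)
    (hσσ : ∀ x, σ (σ x) = x) :
    ∃ f : MvPolynomial (Fin 4) F, f.IsHomogeneous 2 ∧
      (wt t F (hermEval t F f) : ℤ) = t ^ 5 - t ^ 3 - t ^ 2 + t := by
  classical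
  obtain ⟨a, b, c, d, H⟩ := exists_hyperbolicFrame ht hF hσ hσσ
  let f : MvPolynomial (Fin 4) F := (∑ i, C (σ (c i)) * X i) * ∑ i, C (σ (a i)) * X i
  have hf : f.IsHomogeneous 2 :=
    (IsHomogeneous.sum _ _ 1 fun i _ => isHomogeneous_C_mul_X _ i).mul
      (IsHomogeneous.sum _ _ 1 fun i _ => isHomogeneous_C_mul_X _ i)
  have heval : ∀ v, eval v f = hermForm σ v c * hermForm σ v a := fun v => by
    simp [f, hermForm, mul_comm]
  refine ⟨f, hf, ?_⟩
  have hw := wt_hermEval_mul hσ hf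
  have hall := card_isotropic ht hF hσ hσσ
  have hzero : #{v : Fin 4 → F | hermForm σ v v = 0 ∧ eval v f = 0} =
      #{p : (F × F) × (F × F) | (p.1.1 * σ p.2.1 + p.1.2 * σ p.2.2) +
        σ (p.1.1 * σ p.2.1 + p.1.2 * σ p.2.2) = 0 ∧ p.1.1 * p.2.1 = 0} := by
    symm
    refine card_bijective _ (H.frameMap_bijective hσσ) fun p => ?_
    simp only [mem_filter, mem_univ, true_and, heval, H.hermForm_frameMap_self hσσ,
      H.hermForm_frameMap_a hσσ, H.hermForm_frameMap_c hσσ]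
  have hcount := card_hyperbolic_isotropic_inter_planes ht hF hσ hσσ
  rw [← hzero] at hcount
  have hpos : 1 ≤ t ^ 2 := Nat.one_le_pow _ _ (by lia)
  rw [hF] at hw
  zify [hpos] at hw
  have ht' : (1 : ℤ) < t := by exact_mod_cast ht
  have hq : (t ^ 2 - 1 : ℤ) ≠ 0 := by nlinarith
  refine mul_right_cancel₀ hq ?_
  linarith

theorem finrank_hermCode_two (ht : 1 < t) (hF : Fintype.card F = t ^ 2) (hσ : ∀ x, σ x = x ^ t)
    (hσσ : ∀ x, σ (σ x) = x) : Module.finrank F (hermCode t F 2) = 10 := by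
  have hinj : Function.Injective ((hermEval t F).domRestrict (homogeneousSubmodule (Fin 4) F 2)) := by
    refine (injective_iff_map_eq_zero _).2 fun ⟨f, hf⟩ h0 => ?_
    by_contra hf0
    have hle := le_wt_hermEval ht hF hσ hσσ hf fun h => hf0 (Subtype.ext h)
    have h0 : hermEval t F f = 0 := h0
    rw [h0] at hle
    have ht' : (1 : ℤ) < t := by exact_mod_cast ht
    simp only [wt, Pi.zero_apply, ne_eq, not_true_eq_false, Nat.card_of_isEmpty,
      Nat.cast_zero] at hle
    nlinarith [mul_pos (mul_pos (by lia : (0 : ℤ) < t) (sub_pos.2 ht'))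
      (by nlinarith [sq_nonneg (t : ℤ), pow_pos (by lia : (0 : ℤ) < t) 3] : (0 : ℤ) < t ^ 3 + t ^ 2 - 1)]
  rw [hermCode, ← LinearMap.range_domRestrict, LinearMap.finrank_range_of_inj hinj,
    finrank_homogeneousSubmodule]
  rfl

theorem card_hermSurf (ht : 1 < t) (hF : Fintype.card F = t ^ 2) (hσ : ∀ x, σ x = x ^ t)
    (hσσ : ∀ x, σ (σ x) = x) : Nat.card (hermSurf t F) = (t ^ 2 + 1) * (t ^ 3 + 1) := by
  classical
  have hall := card_isotropic ht hF hσ hσσ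
  have h := card_hermSurf_mul (F := F) hσ
  have hpos : 1 ≤ t ^ 2 := Nat.one_le_pow _ _ (by lia)
  rw [hF] at h
  zify [hpos] at h ⊢
  have ht' : (1 : ℤ) < t := by exact_mod_cast ht
  have hq : (t ^ 2 - 1 : ℤ) ≠ 0 := by nlinarith
  refine mul_right_cancel₀ hq ?_
  linarith

end weights

theorem cast_minimum_distance {t : ℕ} (ht : 1 < t) :
    ((t ^ 5 - t ^ 3 - t ^ 2 + t : ℕ) : ℤ) = t ^ 5 - t ^ 3 - t ^ 2 + t := by
  obtain ⟨s, rfl⟩ := Nat.exists_eq_add_of_lt ht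
  have h : (1 + s + 1) ^ 3 + (1 + s + 1) ^ 2 ≤ (1 + s + 1) ^ 5 := by
    ring_nf
    lia
  push_cast [Nat.sub_sub, Nat.cast_sub h]
  ring

/-- The functional code `C₂(X)` of quadratic forms on the Hermitian surface `X` in
`PG(3,t²)` is a `[(t²+1)(t³+1), 10, t⁵-t³-t²+t]`-code, with
`t⁵-t³-t²+t = t(t-1)(t³+t²-1)`. -/
theorem parameters_of_C2 (t : ℕ) (ht : IsPrimePow t) (ht1 : 1 < t)
    (F : Type) [Field F] [Fintype F] (hF : Fintype.card F = t ^ 2) :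
    Nat.card ↥(hermSurf t F) = (t ^ 2 + 1) * (t ^ 3 + 1) ∧
    Module.finrank F ↥(hermCode t F 2) = 10 ∧
    (∀ c ∈ hermCode t F 2, c ≠ 0 → t ^ 5 - t ^ 3 - t ^ 2 + t ≤ wt t F c) ∧
    (∃ c ∈ hermCode t F 2, c ≠ 0 ∧ wt t F c = t ^ 5 - t ^ 3 - t ^ 2 + t) ∧
    t ^ 5 - t ^ 3 - t ^ 2 + t = t * (t - 1) * (t ^ 3 + t ^ 2 - 1) := by
  obtain ⟨σ, hσ, hσσ⟩ := exists_conjugation ht hF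
  refine ⟨card_hermSurf ht1 hF hσ hσσ, finrank_hermCode_two ht1 hF hσ hσσ, ?_, ?_, ?_⟩
  · rintro _ ⟨f, hf, rfl⟩ h0
    rw [← Nat.cast_le (α := ℤ), cast_minimum_distance ht1]
    exact le_wt_hermEval ht1 hF hσ hσσ hf fun h => h0 (by rw [h, map_zero])
  · obtain ⟨f, hf, hw⟩ := exists_wt_hermEval_eq ht1 hF hσ hσσ
    rw [← cast_minimum_distance ht1] at hw
    have hw : wt t F (hermEval t F f) = t ^ 5 - t ^ 3 - t ^ 2 + t := by exact_mod_cast hw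
    refine ⟨_, ⟨f, hf, rfl⟩, fun h0 => ?_, hw⟩
    rw [h0] at hw
    simp [wt] at hw
    lia
  · have h : 1 ≤ t ^ 3 + t ^ 2 := (Nat.one_le_pow 3 t (by lia)).trans (Nat.le_add_right _ _)
    apply Nat.cast_injective (R := ℤ)
    rw [cast_minimum_distance ht1]
    push_cast [h, ht1.le]
    ring
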